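/- Let β ∈ (−1, 1), μ ∈ ℝ, t > 0 and y < 0. Then 2(1−β) e^{2 μ y} ∫₀^∞ ∫₀^t h(t − τ; (1+β) b, μ) · h(τ; (1−β) b − y, −μ) dτ db = ((1−β)/√(2π t)) · e^{−(y − μ t)²/(2 t)} · [ 1 − (β μ / 2) √(2π t) · e^{(−y + β μ t)²/(2 t)} · erfc( (−y + β μ t)/√(2 t) ) ]. -/

import Mathlib

open MeasureTheory Real Set Filter

/-- The auxiliary density `h(t; x, μ) = |x| / √(2π t³) · exp(−(x + μ t)² / (2t))`. -/
noncomputable def h (t x μ : ℝ) : ℝ :=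
  |x| / Real.sqrt (2 * Real.pi * t ^ 3) * Real.exp (-(x + μ * t) ^ 2 / (2 * t))

/-- The complementary error function `erfc(z) = (2/√π) ∫_z^∞ e^{−u²} du`. -/
noncomputable def erfc (z : ℝ) : ℝ :=
  2 / Real.sqrt Real.pi * ∫ u in Ioi z, Real.exp (-u ^ 2)

open scoped Topology

theorem integrable_exp_neg_sq : Integrable fun u : ℝ => Real.exp (-u ^ 2) := by
  simpa using integrable_exp_neg_mul_sq (b := 1) one_pos

theorem erfc_eq_one_sub (z : ℝ) :
    erfc z = 1 - 2 / √π * ∫ u in (0 : ℝ)..z, Real.exp (-u ^ 2) := by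
  have hadd := intervalIntegral.integral_interval_add_Ioi (a := 0) (b := z)
    integrable_exp_neg_sq.integrableOn integrable_exp_neg_sq.integrableOn
  have hgauss : ∫ u in Ioi (0 : ℝ), Real.exp (-u ^ 2) = √π / 2 := by
    simpa using integral_gaussian_Ioi 1
  have hpi : √π ≠ 0 := by positivity
  rw [hgauss] at hadd
  rw [erfc, eq_sub_of_add_eq' hadd]
  field_simp

theorem hasDerivAt_erfc (z : ℝ) :
    HasDerivAt erfc (-(2 / √π) * Real.exp (-z ^ 2)) z := by
  have hcont : Continuous fun u : ℝ => Real.exp (-u ^ 2) := by fun_prop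
  have hd := ((hcont.integral_hasStrictDerivAt 0 z).hasDerivAt.const_mul (2 / √π)).const_sub 1
  rw [neg_mul]
  exact hd.congr_of_eventuallyEq (Eventually.of_forall erfc_eq_one_sub)

theorem tendsto_erfc_atTop : Tendsto erfc atTop (𝓝 0) := by
  have hlim := intervalIntegral_tendsto_integral_Ioi (0 : ℝ)
    integrable_exp_neg_sq.integrableOn tendsto_id
  have hgauss : ∫ u in Ioi (0 : ℝ), Real.exp (-u ^ 2) = √π / 2 := by
    simpa using integral_gaussian_Ioi 1
  have hpi : √π ≠ 0 := by positivity
  rw [hgauss] at hlim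
  have hlim' := (hlim.const_mul (2 / √π)).const_sub 1
  rw [show 1 - 2 / √π * (√π / 2) = 0 by field_simp; ring] at hlim'
  exact hlim'.congr fun z => (erfc_eq_one_sub z).symm

theorem erfc_neg (z : ℝ) : erfc (-z) = 2 - erfc z := by
  have hsymm := intervalIntegral.integral_comp_neg (a := 0) (b := z)
    fun u : ℝ => Real.exp (-u ^ 2)
  simp only [neg_sq, neg_zero] at hsymm
  rw [erfc_eq_one_sub, erfc_eq_one_sub, hsymm, intervalIntegral.integral_symm]
  ring

theorem tendsto_erfc_atBot : Tendsto erfc atBot (𝓝 2) := by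
  have hlim := (tendsto_erfc_atTop.comp tendsto_neg_atBot_atTop).const_sub 2
  rw [sub_zero] at hlim
  exact hlim.congr fun z => by simp [erfc_neg]

theorem sqrt_pow_three {x : ℝ} (hx : 0 ≤ x) : √(x ^ 3) = √x ^ 3 := by
  rw [Real.sqrt_eq_iff_mul_self_eq (by positivity) (by positivity)]
  calc x ^ 3 = (√x ^ 2) ^ 3 := by rw [Real.sq_sqrt hx]
    _ = √x ^ 3 * √x ^ 3 := by ring

theorem h_nonneg (t x μ : ℝ) : 0 ≤ h t x μ := by
  unfold h; positivity

/-- Removing the drift from `h` (Girsanov factor). -/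
theorem h_eq_exp_mul_h_zero (t x μ : ℝ) :
    h t x μ = Real.exp (-(μ * x) - μ ^ 2 * t / 2) * h t x 0 := by
  rcases eq_or_ne t 0 with rfl | ht
  · simp [h]
  · unfold h
    rw [mul_left_comm, ← Real.exp_add]
    congr 2
    field_simp
    ring

/-- The reduced variable in which the convolution of two driftless first passage densities
becomes Gaussian. -/
noncomputable def passageRatio (t a c τ : ℝ) : ℝ :=
  (a * τ - c * (t - τ)) / √(2 * t * τ * (t - τ))

theorem hasDerivAt_passageRatio {t τ : ℝ} (a c : ℝ) (hτ : 0 < τ) (hτt : τ < t) :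
    HasDerivAt (passageRatio t a c)
      (t ^ 2 * (a * τ + c * (t - τ)) / √(2 * t * τ * (t - τ)) ^ 3) τ := by
  have ht : 0 < t := hτ.trans hτt
  have hs : 0 < t - τ := sub_pos.2 hτt
  have hpos : 0 < 2 * t * τ * (t - τ) := by positivity
  have hnum : HasDerivAt (fun r => a * r - c * (t - r)) (a + c) τ := by
    have := ((hasDerivAt_id τ).const_mul a).sub (((hasDerivAt_id τ).const_sub t).const_mul c)
    refine this.congr_deriv ?_
    ring
  have hrad : HasDerivAt (fun r => 2 * t * r * (t - r)) (2 * t * (t - 2 * τ)) τ := by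
    have := ((hasDerivAt_id τ).const_mul (2 * t)).mul ((hasDerivAt_id τ).const_sub t)
    refine this.congr_deriv ?_
    simp only [id]
    ring
  have hD : √(2 * t * τ * (t - τ)) ≠ 0 := by positivity
  have hDsq : √(2 * t * τ * (t - τ)) ^ 2 = 2 * t * τ * (t - τ) := Real.sq_sqrt hpos.le
  refine (hnum.div (hrad.sqrt hpos.ne') hD).congr_deriv ?_
  generalize √(2 * t * τ * (t - τ)) = D at hD hDsq
  field_simp
  rw [hDsq]
  ring

theorem passageRatio_sq {t τ : ℝ} (a c : ℝ) (hτ : 0 < τ) (hτt : τ < t) :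
    passageRatio t a c τ ^ 2
      = a ^ 2 / (2 * (t - τ)) + c ^ 2 / (2 * τ) - (a + c) ^ 2 / (2 * t) := by
  have ht : 0 < t := hτ.trans hτt
  have hs : 0 < t - τ := sub_pos.2 hτt
  rw [passageRatio, div_pow, Real.sq_sqrt (by positivity)]
  field_simp
  ring

theorem tendsto_inv_sqrt_atTop {l : Filter ℝ} {f : ℝ → ℝ} (hf : Tendsto f l (𝓝 0))
    (hpos : ∀ᶠ r in l, 0 < f r) : Tendsto (fun r => (√(f r))⁻¹) l atTop := by
  refine Tendsto.inv_tendsto_nhdsGT_zero (tendsto_nhdsWithin_iff.2 ⟨?_, ?_⟩)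
  · simpa using hf.sqrt
  · filter_upwards [hpos] with r hr using Real.sqrt_pos.2 hr

theorem tendsto_passageRatio_left_atBot {t c : ℝ} (a : ℝ) (ht : 0 < t) (hc : 0 < c) :
    Tendsto (passageRatio t a c) (𝓝[>] 0) atBot := by
  have hinv : Tendsto (fun r => (√(2 * t * r * (t - r)))⁻¹) (𝓝[>] 0) atTop := by
    refine tendsto_inv_sqrt_atTop ?_ ?_
    · have : Continuous fun r => 2 * t * r * (t - r) := by fun_prop
      simpa using (this.tendsto 0).mono_left nhdsWithin_le_nhds
    · filter_upwards [Ioo_mem_nhdsGT ht] with r hr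
      have := sub_pos.2 hr.2
      have := hr.1
      positivity
  have hnum : Tendsto (fun r => a * r - c * (t - r)) (𝓝[>] 0) (𝓝 (-(c * t))) := by
    have : Continuous fun r => a * r - c * (t - r) := by fun_prop
    simpa using (this.tendsto 0).mono_left nhdsWithin_le_nhds
  exact hnum.neg_mul_atTop (neg_lt_zero.2 (mul_pos hc ht)) hinv

theorem tendsto_passageRatio_left_atTop {t c : ℝ} (a : ℝ) (ht : 0 < t) (hc : c < 0) :
    Tendsto (passageRatio t a c) (𝓝[>] 0) atTop := by
  have hlim := tendsto_neg_atBot_atTop.comp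
    (tendsto_passageRatio_left_atBot (-a) ht (neg_pos.2 hc))
  refine hlim.congr fun r => ?_
  simp only [Function.comp, passageRatio, ← neg_div]
  ring_nf

theorem tendsto_passageRatio_right {t a : ℝ} (c : ℝ) (ht : 0 < t) (ha : 0 < a) :
    Tendsto (passageRatio t a c) (𝓝[<] t) atTop := by
  have hinv : Tendsto (fun r => (√(2 * t * r * (t - r)))⁻¹) (𝓝[<] t) atTop := by
    refine tendsto_inv_sqrt_atTop ?_ ?_
    · have : Continuous fun r => 2 * t * r * (t - r) := by fun_prop
      simpa using (this.tendsto t).mono_left nhdsWithin_le_nhds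
    · filter_upwards [Ioo_mem_nhdsLT ht] with r hr
      have := sub_pos.2 hr.2
      have := hr.1
      positivity
  have hnum : Tendsto (fun r => a * r - c * (t - r)) (𝓝[<] t) (𝓝 (a * t)) := by
    have : Continuous fun r => a * r - c * (t - r) := by fun_prop
    simpa using (this.tendsto t).mono_left nhdsWithin_le_nhds
  exact hnum.pos_mul_atTop (mul_pos ha ht) hinv

/-- Fundamental theorem of calculus on an open interval for a nonnegative derivative and a
primitive with limits at both endpoints; integrability is automatic. -/
theorem integral_eq_sub_of_hasDerivAt_of_tendsto_of_nonneg {f f' : ℝ → ℝ} {a b fa fb : ℝ}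
    (hab : a < b) (hderiv : ∀ x ∈ Ioo a b, HasDerivAt f (f' x) x)
    (hnonneg : ∀ x ∈ Ioo a b, 0 ≤ f' x) (ha : Tendsto f (𝓝[>] a) (𝓝 fa))
    (hb : Tendsto f (𝓝[<] b) (𝓝 fb)) : ∫ x in a..b, f' x = fb - fa := by
  have hcont : ContinuousOn f (Ioo a b) := fun x hx =>
    (hderiv x hx).continuousAt.continuousWithinAt
  refine intervalIntegral.integral_eq_sub_of_hasDerivAt_of_tendsto hab hderiv ?_ ha hb
  rw [intervalIntegrable_iff_integrableOn_Ioc_of_le hab.le]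
  refine intervalIntegral.integrableOn_deriv_of_nonneg
    (continuousOn_Icc_extendFrom_Ioo hcont ha hb) (fun x hx => ?_) hnonneg
  refine (hderiv x hx).congr_of_eventuallyEq ?_
  filter_upwards [Ioo_mem_nhds hx.1 hx.2] with r hr
  exact extendFrom_extends hcont r hr

/-- The primitive of the convolution integrand of two driftless first passage densities. -/
noncomputable def passagePrimitive (t a c τ : ℝ) : ℝ :=
  -(1 / (2 * √(2 * π * t ^ 3))) *
    ((a + c) * Real.exp (-(a + c) ^ 2 / (2 * t)) * erfc (passageRatio t a c τ) +
      (c - a) * Real.exp (-(a - c) ^ 2 / (2 * t)) * erfc (passageRatio t a (-c) τ))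

theorem hasDerivAt_passagePrimitive {t a c τ : ℝ} (ha : 0 ≤ a) (hc : 0 ≤ c) (hτ : 0 < τ)
    (hτt : τ < t) :
    HasDerivAt (passagePrimitive t a c) (h (t - τ) a 0 * h τ c 0) τ := by
  have ht : 0 < t := hτ.trans hτt
  have hs : 0 < t - τ := sub_pos.2 hτt
  have hd₁ := (hasDerivAt_erfc _).comp τ (hasDerivAt_passageRatio a c hτ hτt)
  have hd₂ := (hasDerivAt_erfc _).comp τ (hasDerivAt_passageRatio a (-c) hτ hτt)
  have hd := ((hd₁.const_mul ((a + c) * Real.exp (-(a + c) ^ 2 / (2 * t)))).add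
    (hd₂.const_mul ((c - a) * Real.exp (-(a - c) ^ 2 / (2 * t))))).const_mul
      (-(1 / (2 * √(2 * π * t ^ 3))))
  refine hd.congr_deriv ?_
  have hE₁ : Real.exp (-(a + c) ^ 2 / (2 * t)) * Real.exp (-passageRatio t a c τ ^ 2)
      = Real.exp (-a ^ 2 / (2 * (t - τ))) * Real.exp (-c ^ 2 / (2 * τ)) := by
    rw [passageRatio_sq a c hτ hτt, ← Real.exp_add, ← Real.exp_add]
    ring_nf
  have hE₂ : Real.exp (-(a - c) ^ 2 / (2 * t)) * Real.exp (-passageRatio t a (-c) τ ^ 2)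
      = Real.exp (-a ^ 2 / (2 * (t - τ))) * Real.exp (-c ^ 2 / (2 * τ)) := by
    rw [passageRatio_sq a (-c) hτ hτt, ← Real.exp_add, ← Real.exp_add]
    ring_nf
  have hroots : √(2 * π * t ^ 3) * √π * √(2 * t * τ * (t - τ)) ^ 3
      = 2 * t ^ 3 * (√(2 * π * (t - τ) ^ 3) * √(2 * π * τ ^ 3)) := by
    rw [Real.sqrt_mul (by positivity), Real.sqrt_mul (by positivity),
      Real.sqrt_mul (by positivity : 0 ≤ 2 * π), Real.sqrt_mul (by positivity : 0 ≤ 2 * π),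
      Real.sqrt_mul (by positivity : 0 ≤ 2 * t * τ), Real.sqrt_mul (by positivity : 0 ≤ 2 * t),
      Real.sqrt_mul (by positivity : (0 : ℝ) ≤ 2), Real.sqrt_mul (by positivity : (0 : ℝ) ≤ 2),
      sqrt_pow_three ht.le, sqrt_pow_three hs.le, sqrt_pow_three hτ.le]
    have h2 : √(2 : ℝ) ^ 2 = 2 := Real.sq_sqrt (by norm_num)
    have ht2 : √t ^ 2 = t := Real.sq_sqrt ht.le
    calc _ = (√2 ^ 2) * (√t ^ 2) ^ 3 * ((√2 * √π * √(t - τ) ^ 3) * (√2 * √π * √τ ^ 3)) := by ring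
      _ = _ := by rw [h2, ht2]
  have hdens : h (t - τ) a 0 * h τ c 0
      = a * c / (√(2 * π * (t - τ) ^ 3) * √(2 * π * τ ^ 3)) *
        (Real.exp (-a ^ 2 / (2 * (t - τ))) * Real.exp (-c ^ 2 / (2 * τ))) := by
    simp only [h, zero_mul, add_zero, abs_of_nonneg ha, abs_of_nonneg hc]
    ring
  rw [hdens]
  set E := Real.exp (-a ^ 2 / (2 * (t - τ))) * Real.exp (-c ^ 2 / (2 * τ))
  have hR : (√(2 * π * (t - τ) ^ 3) * √(2 * π * τ ^ 3))⁻¹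
      = 2 * t ^ 3 / (√(2 * π * t ^ 3) * √π * √(2 * t * τ * (t - τ)) ^ 3) := by
    rw [hroots]
    field_simp
  rw [div_eq_mul_inv (a * c), hR]
  have h₁ : 0 < √(2 * π * t ^ 3) := by positivity
  have h₂ : 0 < √π := by positivity
  have h₃ : 0 < √(2 * t * τ * (t - τ)) := by positivity
  generalize √(2 * π * t ^ 3) = P at h₁ ⊢
  generalize √π = Q at h₂ ⊢
  generalize √(2 * t * τ * (t - τ)) = D at h₃ ⊢
  calc _ = 1 / (2 * P) * (2 / Q) * (t ^ 2 / D ^ 3) *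
        ((a + c) * (a * τ + c * (t - τ)) * (Real.exp (-(a + c) ^ 2 / (2 * t)) *
          Real.exp (-passageRatio t a c τ ^ 2)) +
        (c - a) * (a * τ - c * (t - τ)) * (Real.exp (-(a - c) ^ 2 / (2 * t)) *
          Real.exp (-passageRatio t a (-c) τ ^ 2))) := by ring
    _ = _ := by
      rw [hE₁, hE₂]
      field_simp
      ring

theorem tendsto_passagePrimitive_left {t a c : ℝ} (ht : 0 < t) (hc : 0 < c) :
    Tendsto (passagePrimitive t a c) (𝓝[>] 0)
      (𝓝 (-((a + c) / √(2 * π * t ^ 3) * Real.exp (-(a + c) ^ 2 / (2 * t))))) := by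
  have h₁ := tendsto_erfc_atBot.comp (tendsto_passageRatio_left_atBot a ht hc)
  have h₂ := tendsto_erfc_atTop.comp (tendsto_passageRatio_left_atTop a ht (neg_lt_zero.2 hc))
  have hlim := ((h₁.const_mul ((a + c) * Real.exp (-(a + c) ^ 2 / (2 * t)))).add
    (h₂.const_mul ((c - a) * Real.exp (-(a - c) ^ 2 / (2 * t))))).const_mul
      (-(1 / (2 * √(2 * π * t ^ 3))))
  have hconst : ∀ k e e' : ℝ, -(1 / (2 * √(2 * π * t ^ 3))) * (k * e * 2 + e' * 0)
      = -(k / √(2 * π * t ^ 3) * e) := by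
    intro k e e'
    ring
  rwa [hconst] at hlim

theorem tendsto_passagePrimitive_right {t a : ℝ} (c : ℝ) (ht : 0 < t) (ha : 0 < a) :
    Tendsto (passagePrimitive t a c) (𝓝[<] t) (𝓝 0) := by
  have h₁ := tendsto_erfc_atTop.comp (tendsto_passageRatio_right c ht ha)
  have h₂ := tendsto_erfc_atTop.comp (tendsto_passageRatio_right (-c) ht ha)
  have hlim := ((h₁.const_mul ((a + c) * Real.exp (-(a + c) ^ 2 / (2 * t)))).add
    (h₂.const_mul ((c - a) * Real.exp (-(a - c) ^ 2 / (2 * t))))).const_mul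
      (-(1 / (2 * √(2 * π * t ^ 3))))
  rwa [mul_zero, mul_zero, add_zero, mul_zero] at hlim

/-- Driftless first passage densities form a convolution semigroup in the level. -/
theorem integral_h_zero_mul_h_zero {t a c : ℝ} (ht : 0 < t) (ha : 0 < a) (hc : 0 < c) :
    ∫ τ in (0 : ℝ)..t, h (t - τ) a 0 * h τ c 0 = h t (a + c) 0 := by
  rw [integral_eq_sub_of_hasDerivAt_of_tendsto_of_nonneg ht
    (fun τ hτ => hasDerivAt_passagePrimitive ha.le hc.le hτ.1 hτ.2)
    (fun _ _ => mul_nonneg (h_nonneg _ _ _) (h_nonneg _ _ _))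
    (tendsto_passagePrimitive_left ht hc) (tendsto_passagePrimitive_right c ht ha)]
  simp [h, abs_of_pos (add_pos ha hc)]

/-- Convolution of first passage densities with opposite drifts. -/
theorem integral_h_mul_h_neg {t a c : ℝ} (μ : ℝ) (ht : 0 < t) (ha : 0 < a) (hc : 0 < c) :
    ∫ τ in (0 : ℝ)..t, h (t - τ) a μ * h τ c (-μ)
      = Real.exp (μ * (c - a) - μ ^ 2 * t / 2) * h t (a + c) 0 := by
  rw [← integral_h_zero_mul_h_zero ht ha hc, ← intervalIntegral.integral_const_mul]
  refine intervalIntegral.integral_congr fun τ _ => ?_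
  rw [h_eq_exp_mul_h_zero _ a, h_eq_exp_mul_h_zero _ c, mul_mul_mul_comm, ← Real.exp_add]
  congr 2
  ring

/-- A Gaussian exponential integral against the driftless first passage density. -/
theorem integral_Ioi_exp_mul_h_zero {t x : ℝ} (m : ℝ) (ht : 0 < t) (hx : 0 ≤ x) :
    ∫ z in Ioi x, Real.exp (-(m * z)) * h t z 0
      = 1 / √(2 * π * t) * (Real.exp (-x ^ 2 / (2 * t) - m * x) -
        m / 2 * √(2 * π * t) * Real.exp (m ^ 2 * t / 2) * erfc ((x + m * t) / √(2 * t))) := by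
  let G : ℝ → ℝ := fun z => -(1 / √(2 * π * t)) * (Real.exp (-z ^ 2 / (2 * t) - m * z) -
        m / 2 * √(2 * π * t) * Real.exp (m ^ 2 * t / 2) * erfc ((z + m * t) / √(2 * t)))
  have hderiv : ∀ z ∈ Ici x, HasDerivAt G (Real.exp (-(m * z)) * h t z 0) z := by
    intro z hz
    have hz0 : 0 ≤ z := hx.trans hz
    have he : HasDerivAt (fun z : ℝ => -z ^ 2 / (2 * t) - m * z) (-(z / t) - m) z := by
      have := (((hasDerivAt_id z).pow 2).neg.div_const (2 * t)).sub
        ((hasDerivAt_id z).const_mul m)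
      refine this.congr_deriv ?_
      simp
      field_simp
    have hl : HasDerivAt (fun z : ℝ => (z + m * t) / √(2 * t)) (1 / √(2 * t)) z :=
      ((hasDerivAt_id z).add_const (m * t)).div_const _
    have hG := (he.exp.sub (((hasDerivAt_erfc _).comp z hl).const_mul
      (m / 2 * √(2 * π * t) * Real.exp (m ^ 2 * t / 2)))).const_mul (-(1 / √(2 * π * t)))
    refine hG.congr_deriv ?_
    have hE : Real.exp (m ^ 2 * t / 2) * Real.exp (-((z + m * t) / √(2 * t)) ^ 2)
        = Real.exp (-z ^ 2 / (2 * t) - m * z) := by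
      rw [← Real.exp_add, div_pow, Real.sq_sqrt (by positivity)]
      congr 1
      field_simp
      ring
    have hE' : Real.exp (-(m * z)) * Real.exp (-z ^ 2 / (2 * t))
        = Real.exp (-z ^ 2 / (2 * t) - m * z) := by
      rw [← Real.exp_add]
      ring_nf
    have hroot : √(2 * π * t) = √π * √(2 * t) := by
      rw [← Real.sqrt_mul pi_pos.le]
      ring_nf
    have hroot' : √(2 * π * t ^ 3) = t * √(2 * π * t) := by
      rw [show 2 * π * t ^ 3 = t ^ 2 * (2 * π * t) by ring, Real.sqrt_mul (by positivity),
        Real.sqrt_sq ht.le]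
    have hden : Real.exp (-(m * z)) * h t z 0
        = z / (t * √(2 * π * t)) * Real.exp (-z ^ 2 / (2 * t) - m * z) := by
      rw [← hE', h, abs_of_nonneg hz0, hroot', zero_mul, add_zero]
      ring
    rw [hden]
    calc _ = 1 / √(2 * π * t) * (Real.exp (-z ^ 2 / (2 * t) - m * z) * (z / t + m) -
          m * (√(2 * π * t) / (√π * √(2 * t))) *
            (Real.exp (m ^ 2 * t / 2) * Real.exp (-((z + m * t) / √(2 * t)) ^ 2))) := by ring
      _ = _ := by
        rw [hE, ← hroot, div_self (by positivity)]
        field_simp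
        ring
  have hlim : Tendsto G atTop (𝓝 0) := by
    have hexp : Tendsto (fun z : ℝ => Real.exp (-z ^ 2 / (2 * t) - m * z)) atTop (𝓝 0) := by
      refine Real.tendsto_exp_atBot.comp ?_
      have hlin : Tendsto (fun z : ℝ => z / (2 * t) + m) atTop atTop :=
        tendsto_atTop_add_const_right _ _ (tendsto_id.atTop_div_const (by positivity))
      refine (tendsto_neg_atTop_atBot.comp (tendsto_id.atTop_mul_atTop₀ hlin)).congr fun z => ?_
      simp only [Function.comp, id]
      ring
    have herfc : Tendsto (fun z : ℝ => erfc ((z + m * t) / √(2 * t))) atTop (𝓝 0) :=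
      tendsto_erfc_atTop.comp
        ((tendsto_atTop_add_const_right _ _ tendsto_id).atTop_div_const (by positivity))
    simpa [G] using (hexp.sub (herfc.const_mul
      (m / 2 * √(2 * π * t) * Real.exp (m ^ 2 * t / 2)))).const_mul (-(1 / √(2 * π * t)))
  rw [integral_Ioi_of_hasDerivAt_of_nonneg' hderiv
    (fun z _ => mul_nonneg (Real.exp_pos _).le (h_nonneg _ _ _)) hlim]
  simp only [G]
  ring

/-- Transition density of skew Brownian motion with one constant drift `μ` (skew level 0,
start at 0), for `y < 0`. -/
theorem sbm_one_drift_density_neg (β μ t y : ℝ)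
    (hβ : β ∈ Ioo (-1 : ℝ) 1) (ht : 0 < t) (hy : y < 0) :
    2 * (1 - β) * Real.exp (2 * μ * y) *
        ∫ b in Ioi (0 : ℝ), ∫ τ in (0 : ℝ)..t,
          h (t - τ) ((1 + β) * b) μ * h τ ((1 - β) * b - y) (-μ)
      = (1 - β) / Real.sqrt (2 * Real.pi * t) * Real.exp (-(y - μ * t) ^ 2 / (2 * t)) *
          (1 - β * μ / 2 * Real.sqrt (2 * Real.pi * t) *
            Real.exp ((-y + β * μ * t) ^ 2 / (2 * t)) *
              erfc ((-y + β * μ * t) / Real.sqrt (2 * t))) := by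
  obtain ⟨hβ₁, hβ₂⟩ := hβ
  have hinner : ∀ b ∈ Ioi (0 : ℝ), (∫ τ in (0 : ℝ)..t,
      h (t - τ) ((1 + β) * b) μ * h τ ((1 - β) * b - y) (-μ))
        = Real.exp (-(μ * (1 + β) * y) - μ ^ 2 * t / 2) *
          (Real.exp (-(β * μ * (2 * b + -y))) * h t (2 * b + -y) 0) := by
    intro b hb
    have hb : 0 < b := hb
    have ha : 0 < (1 + β) * b := mul_pos (by linarith) hb
    have hc : 0 < (1 - β) * b - y := by
      have := mul_pos (sub_pos.2 hβ₂) hb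
      linarith
    rw [integral_h_mul_h_neg μ ht ha hc, ← mul_assoc, ← Real.exp_add]
    ring_nf
  have hchange : (∫ b in Ioi (0 : ℝ), Real.exp (-(β * μ * (2 * b + -y))) * h t (2 * b + -y) 0)
      = 1 / 2 * ∫ z in Ioi (-y), Real.exp (-(β * μ * z)) * h t z 0 := by
    have hscale := integral_comp_mul_left_Ioi
      (fun z => Real.exp (-(β * μ * (z + -y))) * h t (z + -y) 0) 0 (two_pos (α := ℝ))
    have hshift := (measurePreserving_add_right volume (-y)).setIntegral_preimage_emb
      (measurableEmbedding_addRight (-y)) (fun z => Real.exp (-(β * μ * z)) * h t z 0) (Ioi (-y))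
    rw [preimage_add_const_Ioi, sub_self] at hshift
    rw [hscale, mul_zero, hshift, smul_eq_mul, one_div]
  rw [setIntegral_congr_fun measurableSet_Ioi hinner, integral_const_mul, hchange,
    integral_Ioi_exp_mul_h_zero _ ht (by linarith)]
  have hE₁ : Real.exp (2 * μ * y) * Real.exp (-(μ * (1 + β) * y) - μ ^ 2 * t / 2) *
      Real.exp (-(-y) ^ 2 / (2 * t) - β * μ * -y) = Real.exp (-(y - μ * t) ^ 2 / (2 * t)) := by
    rw [← Real.exp_add, ← Real.exp_add]
    congr 1
    field_simp
    ring
  have hE₂ : Real.exp (2 * μ * y) * Real.exp (-(μ * (1 + β) * y) - μ ^ 2 * t / 2) *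
      Real.exp ((β * μ) ^ 2 * t / 2) = Real.exp (-(y - μ * t) ^ 2 / (2 * t)) *
        Real.exp ((-y + β * μ * t) ^ 2 / (2 * t)) := by
    rw [← Real.exp_add, ← Real.exp_add, ← Real.exp_add]
    congr 1
    field_simp
    ring
  linear_combination (1 - β) / √(2 * π * t) * hE₁ -
    (1 - β) / √(2 * π * t) * (β * μ / 2 * √(2 * π * t)) *
      erfc ((-y + β * μ * t) / √(2 * t)) * hE₂
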